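/- arXiv:1904.11891 — 2 statements merged into one kernel-verified Lean document; each statement's English description precedes it below -/
import Mathlib

section
/- Let σ₁, σ₂, β ∈ ℂ be such that sE − A and sÊ − Â are invertible for s ∈ {σ₁, σ₂, β}. Suppose Φ(σ₂)B lies in the range of V, and both Φ(β)ᵀC and Φ(σ₁)ᵀ H⁽²⁾ (Φ(σ₂)B ⊗ Φ(β)ᵀC) lie in the range of W. Then the quadratic transfer functions interpolate: F_H(σ₁, σ₂, β) = F̂_H(σ₁, σ₂, β). -/
open Matrix
open scoped Kronecker

theorem aux_kron {n r : ℕ} (H : Matrix (Fin n) (Fin n × Fin n) ℂ)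
    (V W : Matrix (Fin n) (Fin r) ℂ) (a b : Fin r → ℂ) :
    (Wᵀ * H * (V ⊗ₖ V)) *ᵥ (fun ji : Fin r × Fin r => b ji.1 * a ji.2)
      = Wᵀ *ᵥ (H *ᵥ fun ji : Fin n × Fin n => (V *ᵥ b) ji.1 * (V *ᵥ a) ji.2) := by
  rw [← Matrix.mulVec_mulVec, ← Matrix.mulVec_mulVec]
  congr 2
  ext ⟨j, i⟩
  simp only [Matrix.mulVec, dotProduct, Matrix.kroneckerMap_apply, Fintype.sum_prod_type,
    Finset.sum_mul_sum]
  refine Finset.sum_congr rfl fun x _ => Finset.sum_congr rfl fun y _ => ?_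
  ring

theorem aux_dot {m k : ℕ} (M : Matrix (Fin m) (Fin k) ℂ) (x : Fin m → ℂ) (y : Fin k → ℂ) :
    x ⬝ᵥ (M *ᵥ y) = (Mᵀ *ᵥ x) ⬝ᵥ y := by
  rw [Matrix.dotProduct_mulVec, Matrix.mulVec_transpose]

theorem aux_red {n r : ℕ} (E A : Matrix (Fin n) (Fin n) ℂ) (V W : Matrix (Fin n) (Fin r) ℂ)
    (s : ℂ) : s • (Wᵀ * E * V) - Wᵀ * A * V = Wᵀ * (s • E - A) * V := by
  simp [Matrix.mul_sub, Matrix.sub_mul]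

theorem aux_solve {m : ℕ} (M : Matrix (Fin m) (Fin m) ℂ) (h : IsUnit M) (x y : Fin m → ℂ) :
    M⁻¹ *ᵥ x = y ↔ x = M *ᵥ y := by
  have hd := (Matrix.isUnit_iff_isUnit_det M).1 h
  constructor
  · rintro rfl
    rw [Matrix.mulVec_mulVec, Matrix.mul_nonsing_inv _ hd, Matrix.one_mulVec]
  · rintro rfl
    rw [Matrix.mulVec_mulVec, Matrix.nonsing_inv_mul _ hd, Matrix.one_mulVec]

/-- Two-sided quadratic interpolation using the mode-2 matricization `H⁽²⁾`:
if `Φ(σ₂)B ∈ range V` and both `Φ(β)ᵀC` and `Φ(σ₁)ᵀ H⁽²⁾ (Φ(σ₂)B ⊗ Φ(β)ᵀC)`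
lie in the range of `W`, then `F_H(σ₁, σ₂, β) = F̂_H(σ₁, σ₂, β)`. -/
theorem stmt_8 {n r : ℕ}
    (E A : Matrix (Fin n) (Fin n) ℂ) (H H2 : Matrix (Fin n) (Fin n × Fin n) ℂ)
    (B C : Fin n → ℂ) (V W : Matrix (Fin n) (Fin r) ℂ)
    (Hhat2 : Matrix (Fin r) (Fin r × Fin r) ℂ) (σ₁ σ₂ β : ℂ)
    (hfull1 : IsUnit (σ₁ • E - A)) (hfull2 : IsUnit (σ₂ • E - A))
    (hfull3 : IsUnit (β • E - A))
    (hred1 : IsUnit (σ₁ • (Wᵀ * E * V) - Wᵀ * A * V))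
    (hred2 : IsUnit (σ₂ • (Wᵀ * E * V) - Wᵀ * A * V))
    (hred3 : IsUnit (β • (Wᵀ * E * V) - Wᵀ * A * V))
    -- mode-2 matricization identity for `H2` w.r.t. `H`
    (hH2 : ∀ a b c : Fin n → ℂ,
      c ⬝ᵥ (H *ᵥ fun ji : Fin n × Fin n => b ji.1 * a ji.2)
        = a ⬝ᵥ (H2 *ᵥ fun ji : Fin n × Fin n => b ji.1 * c ji.2))
    -- mode-2 matricization identity for `Ĥ⁽²⁾` w.r.t. `Ĥ = WᵀH(V ⊗ V)`
    (hHhat2 : ∀ a b c : Fin r → ℂ,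
      c ⬝ᵥ ((Wᵀ * H * (V ⊗ₖ V)) *ᵥ fun ji : Fin r × Fin r => b ji.1 * a ji.2)
        = a ⬝ᵥ (Hhat2 *ᵥ fun ji : Fin r × Fin r => b ji.1 * c ji.2))
    (hV2 : ∃ z : Fin r → ℂ, (σ₂ • E - A)⁻¹ *ᵥ B = V *ᵥ z)
    (hW1 : ∃ z : Fin r → ℂ, ((β • E - A)⁻¹)ᵀ *ᵥ C = W *ᵥ z)
    (hW2 : ∃ z : Fin r → ℂ,
      ((σ₁ • E - A)⁻¹)ᵀ *ᵥ (H2 *ᵥ fun ji : Fin n × Fin n =>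
        ((σ₂ • E - A)⁻¹ *ᵥ B) ji.1 * (((β • E - A)⁻¹)ᵀ *ᵥ C) ji.2) = W *ᵥ z) :
    C ⬝ᵥ ((β • E - A)⁻¹ *ᵥ (H *ᵥ fun ji : Fin n × Fin n =>
        ((σ₂ • E - A)⁻¹ *ᵥ B) ji.1 * ((σ₁ • E - A)⁻¹ *ᵥ B) ji.2))
      = (Vᵀ *ᵥ C) ⬝ᵥ ((β • (Wᵀ * E * V) - Wᵀ * A * V)⁻¹ *ᵥ
          ((Wᵀ * H * (V ⊗ₖ V)) *ᵥ fun ji : Fin r × Fin r =>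
            ((σ₂ • (Wᵀ * E * V) - Wᵀ * A * V)⁻¹ *ᵥ (Wᵀ *ᵥ B)) ji.1 *
            ((σ₁ • (Wᵀ * E * V) - Wᵀ * A * V)⁻¹ *ᵥ (Wᵀ *ᵥ B)) ji.2)) := by
  obtain ⟨z, hz⟩ := hV2
  obtain ⟨w, hw⟩ := hW1
  obtain ⟨u, hu⟩ := hW2
  rw [aux_red] at hred1 hred2 hred3
  simp only [aux_red]
  generalize σ₁ • E - A = M1 at *
  generalize σ₂ • E - A = M2 at *
  generalize β • E - A = M3 at *
  have ht : ∀ {m : ℕ} {M : Matrix (Fin m) (Fin m) ℂ}, IsUnit M → IsUnit Mᵀ := by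
    intro m M h
    rw [Matrix.isUnit_iff_isUnit_det] at h ⊢
    rwa [Matrix.det_transpose]
  have hz2 : (Wᵀ * M2 * V)⁻¹ *ᵥ (Wᵀ *ᵥ B) = z := by
    rw [aux_solve _ hred2, (aux_solve _ hfull2 _ _).1 hz]
    simp only [Matrix.mulVec_mulVec, Matrix.mul_assoc]
  have hw2 : ((Wᵀ * M3 * V)⁻¹)ᵀ *ᵥ (Vᵀ *ᵥ C) = w := by
    rw [Matrix.transpose_nonsing_inv] at hw ⊢
    rw [aux_solve _ (ht hred3), (aux_solve _ (ht hfull3) _ _).1 hw]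
    simp only [Matrix.mulVec_mulVec, Matrix.transpose_mul, Matrix.transpose_transpose,
      Matrix.mul_assoc]
  rw [hz, hw] at hu
  rw [aux_dot, aux_dot, hz2, hw2, hz, hw, aux_kron, aux_dot, Matrix.transpose_transpose,
    hH2, hH2]
  generalize (H2 *ᵥ fun ji : Fin n × Fin n => (V *ᵥ z) ji.1 * (W *ᵥ w) ji.2) = q at *
  have hq : q = M1ᵀ *ᵥ (W *ᵥ u) := by
    rw [Matrix.transpose_nonsing_inv] at hu
    exact (aux_solve _ (ht hfull1) _ _).1 hu
  generalize hz1 : (Wᵀ * M1 * V)⁻¹ *ᵥ (Wᵀ *ᵥ B) = z1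
  rw [aux_solve _ hred1] at hz1
  have h1 : (M1⁻¹ *ᵥ B) ⬝ᵥ q = (Wᵀ *ᵥ B) ⬝ᵥ u := by
    rw [← aux_dot, ← hu, aux_dot, Matrix.transpose_transpose]
  rw [h1, hz1, hq, aux_dot, aux_dot]
  simp only [Matrix.mulVec_mulVec, Matrix.transpose_transpose, Matrix.mul_assoc]
end

section
/- Let σ₁, σ₂, σ₃, σ₄ ∈ ℂ be such that σᵢE − A and σᵢÊ − Â are invertible for i = 1, 2, 3, 4. Suppose Φ(σ₁)B, Φ(σ₂)B, Φ(σ₃)B, and Φ(σ₄)H₃(Φ(σ₃)B ⊗ Φ(σ₂)B ⊗ Φ(σ₁)B) all lie in the range of V. Then the cubic transfer functions interpolate: F_{H₃}(σ₁, σ₂, σ₃, σ₄) = F̂_{H₃}(σ₁, σ₂, σ₃, σ₄). -/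
open Matrix
open scoped Kronecker

theorem aux_proj {n r : ℕ} (E A : Matrix (Fin n) (Fin n) ℂ)
    (V W : Matrix (Fin n) (Fin r) ℂ) (s : ℂ) (b : Fin n → ℂ) (z : Fin r → ℂ)
    (h1 : IsUnit (s • E - A)) (h2 : IsUnit (s • (Wᵀ * E * V) - Wᵀ * A * V))
    (h : (s • E - A)⁻¹ *ᵥ b = V *ᵥ z) :
    (s • (Wᵀ * E * V) - Wᵀ * A * V)⁻¹ *ᵥ (Wᵀ *ᵥ b) = z := by
  have hb : b = (s • E - A) *ᵥ (V *ᵥ z) := by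
    rw [← h, Matrix.mulVec_mulVec,
      Matrix.mul_nonsing_inv _ ((Matrix.isUnit_iff_isUnit_det _).1 h1), Matrix.one_mulVec]
  have hr : Wᵀ *ᵥ b = (s • (Wᵀ * E * V) - Wᵀ * A * V) *ᵥ z := by
    rw [hb, Matrix.mulVec_mulVec, Matrix.mulVec_mulVec]
    congr 1
    simp [Matrix.mul_sub, Matrix.sub_mul, Matrix.mul_assoc]
  rw [hr, Matrix.mulVec_mulVec,
    Matrix.nonsing_inv_mul _ ((Matrix.isUnit_iff_isUnit_det _).1 h2), Matrix.one_mulVec]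

theorem aux_kron_s9 {n r m k : Type*} [Fintype r] [Fintype k]
    (V : Matrix n r ℂ) (U : Matrix m k ℂ) (a : r → ℂ) (b : k → ℂ) :
    ((V ⊗ₖ U) *ᵥ fun p : r × k => a p.1 * b p.2) =
      fun p : n × m => (V *ᵥ a) p.1 * (U *ᵥ b) p.2 := by
  ext ⟨i, j⟩
  simp only [Matrix.mulVec, dotProduct, Matrix.kroneckerMap_apply, Fintype.sum_prod_type,
    Finset.sum_mul_sum]
  refine Finset.sum_congr rfl fun x _ => Finset.sum_congr rfl fun y _ => ?_
  ring

/-- Cubic interpolation: if `Φ(σ₁)B`, `Φ(σ₂)B`, `Φ(σ₃)B` and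
`Φ(σ₄)H₃(Φ(σ₃)B ⊗ Φ(σ₂)B ⊗ Φ(σ₁)B)` lie in the range of `V`, then
`F_{H₃}(σ₁, σ₂, σ₃, σ₄) = F̂_{H₃}(σ₁, σ₂, σ₃, σ₄)`. -/
theorem stmt_9 {n r : ℕ}
    (E A : Matrix (Fin n) (Fin n) ℂ)
    (H₃ : Matrix (Fin n) (Fin n × Fin n × Fin n) ℂ)
    (B C : Fin n → ℂ) (V W : Matrix (Fin n) (Fin r) ℂ) (σ₁ σ₂ σ₃ σ₄ : ℂ)
    (hfull1 : IsUnit (σ₁ • E - A)) (hfull2 : IsUnit (σ₂ • E - A))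
    (hfull3 : IsUnit (σ₃ • E - A)) (hfull4 : IsUnit (σ₄ • E - A))
    (hred1 : IsUnit (σ₁ • (Wᵀ * E * V) - Wᵀ * A * V))
    (hred2 : IsUnit (σ₂ • (Wᵀ * E * V) - Wᵀ * A * V))
    (hred3 : IsUnit (σ₃ • (Wᵀ * E * V) - Wᵀ * A * V))
    (hred4 : IsUnit (σ₄ • (Wᵀ * E * V) - Wᵀ * A * V))
    (hV1 : ∃ z : Fin r → ℂ, (σ₁ • E - A)⁻¹ *ᵥ B = V *ᵥ z)
    (hV2 : ∃ z : Fin r → ℂ, (σ₂ • E - A)⁻¹ *ᵥ B = V *ᵥ z)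
    (hV3 : ∃ z : Fin r → ℂ, (σ₃ • E - A)⁻¹ *ᵥ B = V *ᵥ z)
    (hV4 : ∃ z : Fin r → ℂ,
      (σ₄ • E - A)⁻¹ *ᵥ (H₃ *ᵥ fun kji : Fin n × Fin n × Fin n =>
        ((σ₃ • E - A)⁻¹ *ᵥ B) kji.1 * (((σ₂ • E - A)⁻¹ *ᵥ B) kji.2.1 *
          ((σ₁ • E - A)⁻¹ *ᵥ B) kji.2.2)) = V *ᵥ z) :
    C ⬝ᵥ ((σ₄ • E - A)⁻¹ *ᵥ (H₃ *ᵥ fun kji : Fin n × Fin n × Fin n =>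
        ((σ₃ • E - A)⁻¹ *ᵥ B) kji.1 * (((σ₂ • E - A)⁻¹ *ᵥ B) kji.2.1 *
          ((σ₁ • E - A)⁻¹ *ᵥ B) kji.2.2)))
      = (Vᵀ *ᵥ C) ⬝ᵥ ((σ₄ • (Wᵀ * E * V) - Wᵀ * A * V)⁻¹ *ᵥ
          ((Wᵀ * H₃ * (V ⊗ₖ (V ⊗ₖ V))) *ᵥ fun kji : Fin r × Fin r × Fin r =>
            ((σ₃ • (Wᵀ * E * V) - Wᵀ * A * V)⁻¹ *ᵥ (Wᵀ *ᵥ B)) kji.1 *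
            (((σ₂ • (Wᵀ * E * V) - Wᵀ * A * V)⁻¹ *ᵥ (Wᵀ *ᵥ B)) kji.2.1 *
             ((σ₁ • (Wᵀ * E * V) - Wᵀ * A * V)⁻¹ *ᵥ (Wᵀ *ᵥ B)) kji.2.2))) := by
  obtain ⟨z₁, h1⟩ := hV1
  obtain ⟨z₂, h2⟩ := hV2
  obtain ⟨z₃, h3⟩ := hV3
  obtain ⟨z₄, h4⟩ := hV4
  rw [aux_proj E A V W σ₁ B z₁ hfull1 hred1 h1, aux_proj E A V W σ₂ B z₂ hfull2 hred2 h2,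
    aux_proj E A V W σ₃ B z₃ hfull3 hred3 h3]
  have hk : ((V ⊗ₖ (V ⊗ₖ V)) *ᵥ fun kji : Fin r × Fin r × Fin r =>
      z₃ kji.1 * (z₂ kji.2.1 * z₁ kji.2.2)) = fun kji : Fin n × Fin n × Fin n =>
      (V *ᵥ z₃) kji.1 * ((V *ᵥ z₂) kji.2.1 * (V *ᵥ z₁) kji.2.2) := by
    have := aux_kron_s9 V (V ⊗ₖ V) z₃ (fun p : Fin r × Fin r => z₂ p.1 * z₁ p.2)
    rw [aux_kron_s9 V V z₂ z₁] at this
    exact this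
  rw [h1, h2, h3] at h4 ⊢
  rw [← Matrix.mulVec_mulVec, hk, ← Matrix.mulVec_mulVec,
    aux_proj E A V W σ₄ _ z₄ hfull4 hred4 h4, h4, Matrix.dotProduct_mulVec,
    Matrix.mulVec_transpose]
end
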